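/- For every z∈ℂ∖{0} one has M₁(z) − z²·M₃(z) − M₂(z) = −(3π/2)·Σ_{p=1}^∞ p·Γ(p−1/2)/((p+1)·(p!)²) · z^{2p}; consequently the function M₄(z) := z^{-2}·(M₁(z) − z²M₃(z) − M₂(z)) extends to the entire function −(3π/2)·Σ_{p=0}^∞ (p+1)·Γ(p+1/2)/((p+2)·((p+1)!)²) · z^{2p}, which is not identically zero. -/

import Mathlib

open MeasureTheory

/-- `M₁(z) = ∫₀^∞ e^{-r²} (∫₀^{2π} e^{2rz cos θ} cos²θ dθ) dr`. -/
noncomputable def M1 (z : ℂ) : ℂ :=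
  ∫ r in Set.Ioi (0 : ℝ),
    Complex.exp (-(r : ℂ) ^ 2) *
      ∫ θ in (0 : ℝ)..(2 * Real.pi),
        Complex.exp (2 * (r : ℂ) * z * (Real.cos θ : ℂ)) * (Real.cos θ : ℂ) ^ 2

/-- `M₂(z) = ∫₀^∞ e^{-r²} (∫₀^{2π} e^{2rz cos θ} sin²θ dθ) dr`. -/
noncomputable def M2 (z : ℂ) : ℂ :=
  ∫ r in Set.Ioi (0 : ℝ),
    Complex.exp (-(r : ℂ) ^ 2) *
      ∫ θ in (0 : ℝ)..(2 * Real.pi),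
        Complex.exp (2 * (r : ℂ) * z * (Real.cos θ : ℂ)) * (Real.sin θ : ℂ) ^ 2

/-- `M₃(z) = z⁻¹ ∫₀^∞ r⁻¹ e^{-r²} (∫₀^{2π} e^{2rz cos θ} cos θ dθ) dr`, for `z ≠ 0`. -/
noncomputable def M3 (z : ℂ) : ℂ :=
  z⁻¹ * ∫ r in Set.Ioi (0 : ℝ),
    (r : ℂ)⁻¹ * Complex.exp (-(r : ℂ) ^ 2) *
      ∫ θ in (0 : ℝ)..(2 * Real.pi),
        Complex.exp (2 * (r : ℂ) * z * (Real.cos θ : ℂ)) * (Real.cos θ : ℂ)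

/-- The moments `∫₀^{2π} cosⁿ θ dθ`. -/
noncomputable def cosMoment (n : ℕ) : ℝ :=
  ∫ θ in (0 : ℝ)..(2 * Real.pi), Real.cos θ ^ n

lemma cosMoment_zero : cosMoment 0 = 2 * Real.pi := by
  simp [cosMoment]

lemma cosMoment_one : cosMoment 1 = 0 := by
  simp [cosMoment]

lemma cosMoment_add_two (n : ℕ) :
    cosMoment (n + 2) = ((n : ℝ) + 1) / (n + 2) * cosMoment n := by
  simp [cosMoment, integral_cos_pow]

lemma cosMoment_odd (p : ℕ) : cosMoment (2 * p + 1) = 0 := by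
  induction p with
  | zero => exact cosMoment_one
  | succ p ih => rw [show 2 * (p + 1) + 1 = (2 * p + 1) + 2 by ring, cosMoment_add_two, ih, mul_zero]

lemma cosMoment_even (p : ℕ) :
    cosMoment (2 * p) = 2 * Real.pi * (2 * p).factorial / (4 ^ p * (p.factorial : ℝ) ^ 2) := by
  induction p with
  | zero => simp [cosMoment_zero]
  | succ p ih =>
    rw [show 2 * (p + 1) = 2 * p + 2 by ring, cosMoment_add_two, ih,
      Nat.factorial_succ (2 * p + 1), Nat.factorial_succ (2 * p), Nat.factorial_succ p]
    have := Nat.factorial_ne_zero p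
    push_cast
    field_simp
    ring

lemma abs_cosMoment_le (n : ℕ) : |cosMoment n| ≤ 2 * Real.pi := by
  have h := intervalIntegral.norm_integral_le_of_norm_le_const (a := 0) (b := 2 * Real.pi)
    (f := fun θ => Real.cos θ ^ n) (C := 1) fun θ _ => by
      simpa using pow_le_one₀ (abs_nonneg _) (Real.abs_cos_le_one θ)
  simpa [cosMoment, abs_of_pos Real.pi_pos] using h

lemma integral_ofReal_cos_pow (n : ℕ) :
    ∫ θ in (0 : ℝ)..(2 * Real.pi), (Real.cos θ : ℂ) ^ n = (cosMoment n : ℂ) := by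
  rw [cosMoment, ← intervalIntegral.integral_ofReal]
  simp

lemma hasSum_integral_exp_mul_cos_pow (w : ℂ) (k : ℕ) :
    HasSum (fun n : ℕ => w ^ n / n.factorial * (cosMoment (n + k) : ℂ))
      (∫ θ in (0 : ℝ)..(2 * Real.pi),
        Complex.exp (w * (Real.cos θ : ℂ)) * (Real.cos θ : ℂ) ^ k) := by
  have key := intervalIntegral.hasSum_integral_of_dominated_convergence
    (μ := volume) (a := 0) (b := 2 * Real.pi)
    (F := fun (n : ℕ) (θ : ℝ) => w ^ n / n.factorial * (Real.cos θ : ℂ) ^ (n + k))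
    (f := fun θ : ℝ => Complex.exp (w * (Real.cos θ : ℂ)) * (Real.cos θ : ℂ) ^ k)
    (fun n _ => ‖w‖ ^ n / n.factorial)
    (fun n => (by fun_prop : Continuous fun θ : ℝ =>
      w ^ n / n.factorial * (Real.cos θ : ℂ) ^ (n + k)).aestronglyMeasurable)
    (fun n => Filter.Eventually.of_forall fun θ _ => by
      rw [norm_mul, norm_div, norm_pow, norm_pow, Complex.norm_natCast, Complex.norm_real]
      exact mul_le_of_le_one_right (by positivity)
        (pow_le_one₀ (norm_nonneg _) (Real.abs_cos_le_one θ)))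
    (Filter.Eventually.of_forall fun _ _ => Real.summable_pow_div_factorial ‖w‖)
    intervalIntegrable_const
    (Filter.Eventually.of_forall fun θ _ => by
      have h := NormedSpace.expSeries_div_hasSum_exp (w * (Real.cos θ : ℂ))
      rw [← Complex.exp_eq_exp_ℂ] at h
      refine (h.mul_right ((Real.cos θ : ℂ) ^ k)).congr_fun ?_
      intro n
      rw [mul_pow, pow_add]
      ring)
  simpa only [intervalIntegral.integral_const_mul, integral_ofReal_cos_pow] using key

lemma integral_pow_mul_exp_neg_sq (n : ℕ) :
    ∫ r in Set.Ioi (0 : ℝ), (r : ℂ) ^ n * Complex.exp (-(r : ℂ) ^ 2) =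
      ((Real.Gamma (((n : ℝ) + 1) / 2) / 2 : ℝ) : ℂ) := by
  have h := integral_rpow_mul_exp_neg_rpow (p := 2) (q := n) (by norm_num)
    (by have : (0 : ℝ) ≤ n := n.cast_nonneg
        linarith)
  rw [div_eq_inv_mul, ← one_div, ← h, ← integral_complex_ofReal]
  refine setIntegral_congr_fun measurableSet_Ioi fun r _ => ?_
  simp

lemma integrable_exp_neg_sq_mul_exp (A : ℝ) :
    Integrable fun r : ℝ => Real.exp (-r ^ 2) * Real.exp (A * r) := by
  have h := (integrable_cexp_quadratic (b := 1) (by simp) (A : ℂ) 0).norm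
  refine h.congr (Filter.Eventually.of_forall fun r => ?_)
  simp only [Complex.norm_exp, ← Real.exp_add]
  congr 1
  simp [← Complex.ofReal_pow]

lemma hasSum_integral_exp_neg_sq_mul {a : ℕ → ℂ} {A C : ℝ}
    (ha : ∀ n, ‖a n‖ ≤ C * (A ^ n / n.factorial)) {f : ℝ → ℂ}
    (hf : ∀ r : ℝ, 0 < r → HasSum (fun n => a n * (r : ℂ) ^ n) (f r)) :
    HasSum (fun n : ℕ => a n * ((Real.Gamma (((n : ℝ) + 1) / 2) / 2 : ℝ) : ℂ))
      (∫ r in Set.Ioi (0 : ℝ), Complex.exp (-(r : ℂ) ^ 2) * f r) := by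
  have hsum (r : ℝ) : HasSum (fun n : ℕ => C * Real.exp (-r ^ 2) * ((A * r) ^ n / n.factorial))
      (C * (Real.exp (-r ^ 2) * Real.exp (A * r))) := by
    have h := NormedSpace.expSeries_div_hasSum_exp (A * r)
    rw [← Real.exp_eq_exp_ℝ] at h
    simpa only [mul_assoc] using h.mul_left (C * Real.exp (-r ^ 2))
  have key := hasSum_integral_of_dominated_convergence
    (μ := volume.restrict (Set.Ioi (0 : ℝ)))
    (F := fun (n : ℕ) (r : ℝ) => a n * ((r : ℂ) ^ n * Complex.exp (-(r : ℂ) ^ 2)))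
    (f := fun r : ℝ => Complex.exp (-(r : ℂ) ^ 2) * f r)
    (fun n r => C * Real.exp (-r ^ 2) * ((A * r) ^ n / n.factorial))
    (fun n => (by fun_prop : Continuous fun r : ℝ =>
      a n * ((r : ℂ) ^ n * Complex.exp (-(r : ℂ) ^ 2))).aestronglyMeasurable)
    (fun n => (ae_restrict_mem measurableSet_Ioi).mono fun r hr => by
      have hr' : (0 : ℝ) < r := hr
      rw [norm_mul, norm_mul, norm_pow, Complex.norm_real, Real.norm_of_nonneg hr'.le,
        Complex.norm_exp, show (-(r : ℂ) ^ 2).re = -r ^ 2 by simp [← Complex.ofReal_pow]]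
      calc _ ≤ C * (A ^ n / n.factorial) * (r ^ n * Real.exp (-r ^ 2)) :=
            mul_le_mul_of_nonneg_right (ha n) (by positivity)
        _ = _ := by rw [mul_pow]; ring)
    (Filter.Eventually.of_forall fun r => (hsum r).summable)
    (by
      simp only [fun r => (hsum r).tsum_eq]
      exact ((integrable_exp_neg_sq_mul_exp A).const_mul C).integrableOn)
    ((ae_restrict_mem measurableSet_Ioi).mono fun r hr => by
      refine ((hf r hr).mul_left (Complex.exp (-(r : ℂ) ^ 2))).congr_fun fun n => ?_
      ring)
  simpa only [integral_const_mul, integral_pow_mul_exp_neg_sq] using key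

lemma hasSum_comp_two_mul {f : ℕ → ℂ} {s : ℂ} (hf : HasSum f s)
    (hodd : ∀ p, f (2 * p + 1) = 0) : HasSum (fun p => f (2 * p)) s := by
  refine (Function.Injective.hasSum_iff (g := fun p : ℕ => 2 * p)
    (fun a b h => by simpa using h) fun n hn => ?_).2 hf
  obtain ⟨p, rfl | rfl⟩ := n.even_or_odd'
  · exact absurd ⟨p, rfl⟩ hn
  · exact hodd p

lemma norm_two_mul_pow_div_factorial_mul_le (z : ℂ) {x C : ℝ} (hx : |x| ≤ C) (n : ℕ) :
    ‖(2 * z) ^ n / n.factorial * (x : ℂ)‖ ≤ C * ((2 * ‖z‖) ^ n / n.factorial) := by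
  rw [norm_mul, norm_div, norm_pow, norm_mul, Complex.norm_natCast, Complex.norm_real,
    Complex.norm_ofNat, mul_comm]
  exact mul_le_mul_of_nonneg_right hx (by positivity)

lemma hasSum_M1 (z : ℂ) :
    HasSum (fun n : ℕ => (2 * z) ^ n / n.factorial * (cosMoment (n + 2) : ℂ) *
      ((Real.Gamma (((n : ℝ) + 1) / 2) / 2 : ℝ) : ℂ)) (M1 z) := by
  refine hasSum_integral_exp_neg_sq_mul
    (fun n => norm_two_mul_pow_div_factorial_mul_le z (abs_cosMoment_le _) n) fun r _ => ?_
  refine (hasSum_integral_exp_mul_cos_pow (2 * r * z) 2).congr_fun fun n => ?_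
  rw [mul_right_comm 2 (r : ℂ) z, mul_pow _ (r : ℂ)]
  ring

lemma hasSum_M2 (z : ℂ) :
    HasSum (fun n : ℕ => (2 * z) ^ n / n.factorial *
      ((cosMoment n - cosMoment (n + 2) : ℝ) : ℂ) *
      ((Real.Gamma (((n : ℝ) + 1) / 2) / 2 : ℝ) : ℂ)) (M2 z) := by
  refine hasSum_integral_exp_neg_sq_mul
    (fun n => norm_two_mul_pow_div_factorial_mul_le z
      ((abs_sub _ _).trans (add_le_add (abs_cosMoment_le _) (abs_cosMoment_le _))) n)
    fun r _ => ?_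
  have h := (hasSum_integral_exp_mul_cos_pow (2 * r * z) 0).sub
    (hasSum_integral_exp_mul_cos_pow (2 * r * z) 2)
  rw [← intervalIntegral.integral_sub
    ((by fun_prop : Continuous _).intervalIntegrable _ _)
    ((by fun_prop : Continuous _).intervalIntegrable _ _)] at h
  have hsin : ∫ θ in (0 : ℝ)..(2 * Real.pi),
        Complex.exp (2 * (r : ℂ) * z * (Real.cos θ : ℂ)) * (Real.sin θ : ℂ) ^ 2 =
      ∫ θ in (0 : ℝ)..(2 * Real.pi),
        (Complex.exp (2 * (r : ℂ) * z * (Real.cos θ : ℂ)) * (Real.cos θ : ℂ) ^ 0 -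
          Complex.exp (2 * (r : ℂ) * z * (Real.cos θ : ℂ)) * (Real.cos θ : ℂ) ^ 2) := by
    congr 1
    funext θ
    rw [← Complex.ofReal_pow (Real.sin θ), Real.sin_sq]
    push_cast
    ring
  rw [hsin]
  refine h.congr_fun fun n => ?_
  rw [mul_right_comm 2 (r : ℂ) z, mul_pow _ (r : ℂ), add_zero]
  push_cast
  ring

lemma hasSum_sq_mul_M3 {z : ℂ} (hz : z ≠ 0) :
    HasSum (fun n : ℕ => z * (2 * z * ((2 * z) ^ n / n.factorial *
      ((cosMoment (n + 2) / (n + 1) : ℝ) : ℂ)) *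
      ((Real.Gamma (((n : ℝ) + 1) / 2) / 2 : ℝ) : ℂ))) (z ^ 2 * M3 z) := by
  have hM : z ^ 2 * M3 z = z * ∫ r in Set.Ioi (0 : ℝ), Complex.exp (-(r : ℂ) ^ 2) *
      ((r : ℂ)⁻¹ * ∫ θ in (0 : ℝ)..(2 * Real.pi),
        Complex.exp (2 * (r : ℂ) * z * (Real.cos θ : ℂ)) * (Real.cos θ : ℂ)) := by
    rw [M3, pow_two, mul_assoc, mul_inv_cancel_left₀ hz]
    congr 2
    funext r
    ring
  rw [hM]
  refine HasSum.mul_left z ?_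
  refine hasSum_integral_exp_neg_sq_mul (A := 2 * ‖z‖) (C := 2 * ‖z‖ * (2 * Real.pi))
    (fun n => ?_) fun r hr => ?_
  · rw [norm_mul, mul_assoc (2 * ‖z‖)]
    refine mul_le_mul (by simp) (norm_two_mul_pow_div_factorial_mul_le z ?_ n)
      (norm_nonneg _) (by positivity)
    have hn : (0 : ℝ) < n + 1 := by positivity
    rw [abs_div, abs_of_pos hn]
    exact (div_le_self (abs_nonneg _) (by simp)).trans (abs_cosMoment_le _)
  · have h := (hasSum_nat_add_iff' 1).2 (hasSum_integral_exp_mul_cos_pow (2 * r * z) 1)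
    simp only [Finset.sum_range_one, zero_add, cosMoment_one, Complex.ofReal_zero, mul_zero,
      sub_zero, pow_one] at h
    refine (h.mul_left (r : ℂ)⁻¹).congr_fun fun n => ?_
    have hr' : (r : ℂ) ≠ 0 := by exact_mod_cast hr.ne'
    have hn : (n : ℂ) + 1 ≠ 0 := by exact_mod_cast n.succ_ne_zero
    have hfac := n.factorial_ne_zero
    rw [Nat.factorial_succ, mul_right_comm 2 (r : ℂ) z, mul_pow _ (r : ℂ)]
    push_cast
    field_simp
    ring_nf

/-- The real coefficient of `z ^ (2 * p)` in the expansion of `M₄`, without the factor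
`-(3π/2)`. -/
noncomputable def M4Coeff (p : ℕ) : ℝ :=
  ((p : ℝ) + 1) * Real.Gamma ((p : ℝ) + 1 / 2) /
    (((p : ℝ) + 2) * ((Nat.factorial (p + 1) : ℝ)) ^ 2)

lemma M4Coeff_eq (p : ℕ) :
    ((p : ℝ) + 1) * Real.Gamma (((p : ℝ) + 1) - 1 / 2) /
      ((((p : ℝ) + 1) + 1) * ((Nat.factorial (p + 1) : ℝ)) ^ 2) = M4Coeff p := by
  rw [M4Coeff, show (p : ℝ) + 1 - 1 / 2 = p + 1 / 2 by ring, show (p : ℝ) + 1 + 1 = p + 2 by ring]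

lemma coeff_identity (p : ℕ) :
    2 ^ (2 * (p + 1)) / (2 * (p + 1)).factorial *
        (2 * cosMoment (2 * (p + 1) + 2) - cosMoment (2 * (p + 1))) *
        (Real.Gamma (((2 * (p + 1) : ℕ) + 1 : ℝ) / 2) / 2) -
      2 * (2 ^ (2 * p) / (2 * p).factorial * (cosMoment (2 * p + 2) / ((2 * p : ℕ) + 1))) *
        (Real.Gamma (((2 * p : ℕ) + 1 : ℝ) / 2) / 2) =
    -(3 * Real.pi / 2) * M4Coeff p := by
  have hp : (0 : ℝ) < p + 1 / 2 := by positivity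
  have hG : Real.Gamma (((2 * (p + 1) : ℕ) + 1 : ℝ) / 2) =
      (p + 1 / 2) * Real.Gamma (p + 1 / 2) := by
    rw [← Real.Gamma_add_one hp.ne']
    congr 1
    push_cast
    ring
  have hG' : Real.Gamma (((2 * p : ℕ) + 1 : ℝ) / 2) = Real.Gamma (p + 1 / 2) := by
    congr 1
    push_cast
    ring
  have h4 : (2 : ℝ) ^ (2 * p) = 4 ^ p := by rw [pow_mul]; norm_num
  have hfac : (p.factorial : ℝ) ≠ 0 := by exact_mod_cast p.factorial_ne_zero
  have hfac2 : ((2 * p).factorial : ℝ) ≠ 0 := by exact_mod_cast (2 * p).factorial_ne_zero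
  rw [hG, hG', M4Coeff, cosMoment_add_two (2 * (p + 1)), show 2 * (p + 1) = 2 * p + 2 by ring,
    cosMoment_add_two (2 * p), cosMoment_even p, Nat.factorial_succ (2 * p + 1),
    Nat.factorial_succ (2 * p), Nat.factorial_succ p, pow_add 2 (2 * p), h4]
  push_cast
  field_simp
  ring

lemma hasSum_combination {z : ℂ} (hz : z ≠ 0) :
    HasSum (fun p : ℕ => -(3 * (Real.pi : ℂ) / 2) * ((M4Coeff p : ℂ) * z ^ (2 * (p + 1))))
      (M1 z - z ^ 2 * M3 z - M2 z) := by
  have hD := hasSum_comp_two_mul ((hasSum_M1 z).sub (hasSum_M2 z)) fun p => by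
    rw [show 2 * p + 1 + 2 = 2 * (p + 1) + 1 by ring, cosMoment_odd, cosMoment_odd]
    simp
  have hT := hasSum_comp_two_mul (hasSum_sq_mul_M3 hz) fun p => by
    rw [show 2 * p + 1 + 2 = 2 * (p + 1) + 1 by ring, cosMoment_odd]
    simp
  have hD' := (hasSum_nat_add_iff' 1).2 hD
  have h0 : cosMoment 2 = cosMoment 0 / 2 := by
    rw [show 2 = 0 + 2 from rfl, cosMoment_add_two]
    norm_num
    ring
  have hval : M1 z - z ^ 2 * M3 z - M2 z = M1 z - M2 z - 0 - z ^ 2 * M3 z := by ring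
  rw [Finset.sum_range_one, mul_zero, zero_add, h0,
    show ∀ x : ℝ, x - x / 2 = x / 2 by intro x; ring, sub_self] at hD'
  rw [hval]
  refine (hD'.sub hT).congr_fun fun p => ?_
  have h := congrArg (fun x : ℝ => (x : ℂ) * z ^ (2 * (p + 1))) (coeff_identity p)
  push_cast at h ⊢
  rw [← mul_assoc, ← h, mul_pow 2 z, mul_pow 2 z]
  ring

lemma summable_M4 (z : ℂ) : Summable fun p : ℕ => (M4Coeff p : ℂ) * z ^ (2 * p) := by
  rcases eq_or_ne z 0 with rfl | hz
  · refine summable_of_ne_finset_zero (s := {0}) fun p hp => ?_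
    have : p ≠ 0 := by simpa using hp
    simp [this]
  · have hc : -(3 * (Real.pi : ℂ) / 2) * z ^ 2 ≠ 0 := by
      have : (Real.pi : ℂ) ≠ 0 := by exact_mod_cast Real.pi_ne_zero
      simp [this, hz]
    refine (summable_mul_left_iff hc).1 ((hasSum_combination hz).summable.congr fun p => ?_)
    ring

lemma differentiable_tsum_M4 :
    Differentiable ℂ fun z : ℂ => ∑' p : ℕ, (M4Coeff p : ℂ) * z ^ (2 * p) := by
  intro z
  have hz : z ∈ Metric.ball (0 : ℂ) (‖z‖ + 1) := by simp
  refine (Complex.differentiableOn_tsum_of_summable_norm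
    (summable_M4 ((‖z‖ + 1 : ℝ) : ℂ)).norm (fun p => by fun_prop) Metric.isOpen_ball
    fun p w hw => ?_).differentiableAt (Metric.isOpen_ball.mem_nhds hz)
  have hw' : ‖w‖ ≤ ‖z‖ + 1 := (mem_ball_zero_iff.1 hw).le
  rw [norm_mul, norm_mul, norm_pow, norm_pow, Complex.norm_real (‖z‖ + 1),
    Real.norm_of_nonneg (by positivity : 0 ≤ ‖z‖ + 1)]
  gcongr

/-- For `z ≠ 0`, `M₁(z) − z²M₃(z) − M₂(z) = −(3π/2) Σ_{p≥1} pΓ(p−1/2)/((p+1)(p!)²) z^{2p}`;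
consequently `M₄(z) := z⁻²(M₁(z) − z²M₃(z) − M₂(z))` extends to the entire function
`−(3π/2) Σ_{p≥0} (p+1)Γ(p+1/2)/((p+2)((p+1)!)²) z^{2p}`, which is not identically zero. -/
theorem stmt6 :
    (∀ z : ℂ, Summable (fun p : ℕ =>
        ((((p : ℝ) + 1) * Real.Gamma (((p : ℝ) + 1) - 1 / 2) /
            ((((p : ℝ) + 1) + 1) * ((Nat.factorial (p + 1) : ℝ)) ^ 2) : ℝ) : ℂ)
          * z ^ (2 * (p + 1)))) ∧
    (∀ z : ℂ, z ≠ 0 → M1 z - z ^ 2 * M3 z - M2 z =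
        -(3 * (Real.pi : ℂ) / 2) * ∑' p : ℕ,
          ((((p : ℝ) + 1) * Real.Gamma (((p : ℝ) + 1) - 1 / 2) /
              ((((p : ℝ) + 1) + 1) * ((Nat.factorial (p + 1) : ℝ)) ^ 2) : ℝ) : ℂ)
            * z ^ (2 * (p + 1))) ∧
    (∀ z : ℂ, Summable (fun p : ℕ =>
        ((((p : ℝ) + 1) * Real.Gamma ((p : ℝ) + 1 / 2) /
            (((p : ℝ) + 2) * ((Nat.factorial (p + 1) : ℝ)) ^ 2) : ℝ) : ℂ)
          * z ^ (2 * p))) ∧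
    (∃ g : ℂ → ℂ, Differentiable ℂ g ∧
      (∀ z : ℂ, g z =
        -(3 * (Real.pi : ℂ) / 2) * ∑' p : ℕ,
          ((((p : ℝ) + 1) * Real.Gamma ((p : ℝ) + 1 / 2) /
              (((p : ℝ) + 2) * ((Nat.factorial (p + 1) : ℝ)) ^ 2) : ℝ) : ℂ)
            * z ^ (2 * p)) ∧
      (∀ z : ℂ, z ≠ 0 → g z = (z ^ 2)⁻¹ * (M1 z - z ^ 2 * M3 z - M2 z)) ∧
      (∃ z : ℂ, g z ≠ 0)) := by
  have hsum (z : ℂ) : Summable fun p : ℕ => (M4Coeff p : ℂ) * z ^ (2 * (p + 1)) :=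
    ((summable_M4 z).mul_left (z ^ 2)).congr fun p => by ring
  have hdiff {z : ℂ} (hz : z ≠ 0) : M1 z - z ^ 2 * M3 z - M2 z =
      -(3 * (Real.pi : ℂ) / 2) * ∑' p : ℕ, (M4Coeff p : ℂ) * z ^ (2 * (p + 1)) := by
    rw [← tsum_mul_left, (hasSum_combination hz).tsum_eq]
  simp only [M4Coeff_eq]
  refine ⟨hsum, fun z hz => hdiff hz, summable_M4,
    fun z => -(3 * (Real.pi : ℂ) / 2) * ∑' p : ℕ, (M4Coeff p : ℂ) * z ^ (2 * p),
    differentiable_tsum_M4.const_mul _, fun z => rfl, fun z hz => ?_, 0, ?_⟩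
  · have hshift : ∑' p : ℕ, (M4Coeff p : ℂ) * z ^ (2 * (p + 1)) =
        z ^ 2 * ∑' p : ℕ, (M4Coeff p : ℂ) * z ^ (2 * p) := by
      rw [← tsum_mul_left]
      exact tsum_congr fun p => by ring
    rw [hdiff hz, hshift, mul_left_comm _ (z ^ 2), inv_mul_cancel_left₀ (pow_ne_zero 2 hz)]
  · have h0 : M4Coeff 0 ≠ 0 := by
      have := Real.Gamma_pos_of_pos (show (0 : ℝ) < 1 / 2 by norm_num)
      simp only [M4Coeff, Nat.cast_zero, zero_add]
      positivity
    beta_reduce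
    rw [tsum_eq_single 0 fun p hp => by simp [hp]]
    simp [h0, Real.pi_ne_zero]
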